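/- arXiv:1212.3418 — 4 statements merged into one kernel-verified Lean document; each statement's English description precedes it below -/
import Mathlib

section
/- If C is a configuration whose underlying graph is a rooted tree with root r, then after any execution step C →_A C', the underlying graph of C' is still a directed rooted tree with the same root r. -/
open scoped Classical

/-- A pre-configuration: a finite node set `V` with a partial parent map
(`none` means the node has no parent) and an integer height assignment. -/
structure PreConfig (V : Type*) where
  parent : V → Option V
  height : V → ℤ

namespace PreConfig

variable {V : Type*} [Fintype V] [LinearOrder V]

/-- The children of `u` are the nodes whose parent is `u`. -/
noncomputable def children (C : PreConfig V) (u : V) : Finset V :=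
  Finset.univ.filter (fun v => C.parent v = some u)

/-- A leaf is a node with no children. -/
def IsLeaf (C : PreConfig V) (u : V) : Prop := C.children u = ∅

/-- Maximum height value among the children of `u` (junk value `0` for a leaf). -/
noncomputable def maxH (C : PreConfig V) (u : V) : ℤ :=
  if h : (C.children u).Nonempty then (C.children u).sup' h C.height else 0

/-- Minimum height value among the children of `u` (junk value `0` for a leaf). -/
noncomputable def minH (C : PreConfig V) (u : V) : ℤ :=
  if h : (C.children u).Nonempty then (C.children u).inf' h C.height else 0

/-- A child of `u` of maximum height value; ties broken by a fixed rule
(smallest ID). Junk value `u` for a leaf. -/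
noncomputable def maxChild (C : PreConfig V) (u : V) : V :=
  if h : ((C.children u).filter fun v => C.height v = C.maxH u).Nonempty
  then ((C.children u).filter fun v => C.height v = C.maxH u).min' h else u

/-- A child of `u` of minimum height value; ties broken by a fixed rule
(smallest ID). Junk value `u` for a leaf. -/
noncomputable def minChild (C : PreConfig V) (u : V) : V :=
  if h : ((C.children u).filter fun v => C.height v = C.minH u).Nonempty
  then ((C.children u).filter fun v => C.height v = C.minH u).min' h else u

/-- `stable(u)`: `h(u) = 0` if `u` is a leaf, and `h(u) = 1 + max_{w child of u} h(w)` otherwise. -/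
def Stable (C : PreConfig V) (u : V) : Prop :=
  (C.IsLeaf u ∧ C.height u = 0) ∨ (¬ C.IsLeaf u ∧ C.height u = 1 + C.maxH u)

/-- `balanced(u)`: `|h(z) − h(z')| ≤ α` for all children `z, z'` of `u`. -/
def Balanced (α : ℤ) (C : PreConfig V) (u : V) : Prop :=
  ∀ z ∈ C.children u, ∀ z' ∈ C.children u, |C.height z - C.height z'| ≤ α

/-- `u` is enabled for a height update iff `¬stable(u)`. -/
def UpdateEnabled (C : PreConfig V) (u : V) : Prop := ¬ C.Stable u

/-- `u` is enabled for a swap iff `stable(u) ∧ stable(max(u)) ∧ ¬balanced(u)`. -/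
def SwapEnabled (α : ℤ) (C : PreConfig V) (u : V) : Prop :=
  C.Stable u ∧ C.Stable (C.maxChild u) ∧ ¬ Balanced α C u

/-- `u` is enabled iff it is enabled for a height update or for a swap. -/
def Enabled (α : ℤ) (C : PreConfig V) (u : V) : Prop :=
  C.UpdateEnabled u ∨ SwapEnabled α C u

/-- The value written by a height update: `0` for a leaf, `1 + max_{w child of u} h(w)` otherwise. -/
noncomputable def newHeight (C : PreConfig V) (u : V) : ℤ :=
  if C.IsLeaf u then 0 else 1 + C.maxH u

/-- A bad node: an internal node `u` with `h(u) ≤ max_{v child of u} h(v)`,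
or a leaf `u` with `h(u) < 0`. -/
def Bad (C : PreConfig V) (u : V) : Prop :=
  (¬ C.IsLeaf u ∧ C.height u ≤ C.maxH u) ∨ (C.IsLeaf u ∧ C.height u < 0)

/-- `v` reaches `a` by iterating the parent map. -/
def Reaches (C : PreConfig V) (v a : V) : Prop :=
  Relation.ReflTransGen (fun x y => C.parent x = some y) v a

/-- The underlying graph is a rooted tree with root `r`: `r` has no parent,
every other node has a (unique) parent, and every node reaches `r` by
iterating the parent map. -/
def IsTree (C : PreConfig V) (r : V) : Prop :=
  C.parent r = none ∧ (∀ v, C.parent v = none → v = r) ∧ ∀ v, C.Reaches v r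

/-- The subtree `S_u` of `u`: the set of descendants of `u` (including `u`). -/
def subtree (C : PreConfig V) (u : V) : Set V := {v | C.Reaches v u}

/-- The actual height `h*(u)` of `u`: the length of a longest directed path
going downward from `u` (such a maximal path necessarily ends at a leaf of `S_u`). -/
noncomputable def hstar (C : PreConfig V) (u : V) : ℕ :=
  sSup {n : ℕ | ∃ f : ℕ → V, f 0 = u ∧ ∀ i < n, C.parent (f (i + 1)) = some (f i)}

/-- An execution step `C →_A C'`: a nonempty set `A` of nodes enabled in `C` is
activated simultaneously; each `u ∈ A` enabled for a height update sets its height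
to `newHeight`; each `u ∈ A` enabled for a swap replaces the edges `(u, min(u))` and
`(max(u), max(max(u)))` by `(u, max(max(u)))` and `(max(u), min(u))` (all guards and
functions evaluated in `C`); everything else is unchanged. -/
structure Step (α : ℤ) (C C' : PreConfig V) (A : Finset V) : Prop where
  nonempty : A.Nonempty
  all_enabled : ∀ u ∈ A, Enabled α C u
  height_update : ∀ u ∈ A, C.UpdateEnabled u → C'.height u = C.newHeight u
  height_keep : ∀ u, ¬ (u ∈ A ∧ C.UpdateEnabled u) → C'.height u = C.height u
  swap_out : ∀ u ∈ A, SwapEnabled α C u → C'.parent (C.minChild u) = some (C.maxChild u)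
  swap_in : ∀ u ∈ A, SwapEnabled α C u → C'.parent (C.maxChild (C.maxChild u)) = some u
  parent_keep : ∀ v, (∀ u ∈ A, SwapEnabled α C u →
      v ≠ C.minChild u ∧ v ≠ C.maxChild (C.maxChild u)) → C'.parent v = C.parent v

end PreConfig

namespace PreConfig

variable {V : Type*} [Fintype V] [LinearOrder V]

theorem mem_children {C : PreConfig V} {u v : V} :
    v ∈ C.children u ↔ C.parent v = some u := by
  simp [children]

theorem height_le_maxH {C : PreConfig V} {u v : V} (hv : v ∈ C.children u) :
    C.height v ≤ C.maxH u := by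
  rw [maxH, dif_pos ⟨v, hv⟩]
  exact Finset.le_sup' C.height hv

theorem minH_le_height {C : PreConfig V} {u v : V} (hv : v ∈ C.children u) :
    C.minH u ≤ C.height v := by
  rw [minH, dif_pos ⟨v, hv⟩]
  exact Finset.inf'_le C.height hv

theorem maxChild_spec {C : PreConfig V} {u : V} (h : ¬ C.IsLeaf u) :
    C.parent (C.maxChild u) = some u ∧ C.height (C.maxChild u) = C.maxH u := by
  have hne : (C.children u).Nonempty := Finset.nonempty_iff_ne_empty.2 h
  have hf : ((C.children u).filter fun v => C.height v = C.maxH u).Nonempty := by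
    obtain ⟨v, hv, hmax⟩ := Finset.exists_mem_eq_sup' hne C.height
    exact ⟨v, Finset.mem_filter.2 ⟨hv, by rw [maxH, dif_pos hne, hmax]⟩⟩
  have hmem := Finset.min'_mem _ hf
  rw [maxChild, dif_pos hf]
  exact (Finset.mem_filter.1 hmem).imp_left mem_children.1

theorem minChild_spec {C : PreConfig V} {u : V} (h : ¬ C.IsLeaf u) :
    C.parent (C.minChild u) = some u ∧ C.height (C.minChild u) = C.minH u := by
  have hne : (C.children u).Nonempty := Finset.nonempty_iff_ne_empty.2 h
  have hf : ((C.children u).filter fun v => C.height v = C.minH u).Nonempty := by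
    obtain ⟨v, hv, hmin⟩ := Finset.exists_mem_eq_inf' hne C.height
    exact ⟨v, Finset.mem_filter.2 ⟨hv, by rw [minH, dif_pos hne, hmin]⟩⟩
  have hmem := Finset.min'_mem _ hf
  rw [minChild, dif_pos hf]
  exact (Finset.mem_filter.1 hmem).imp_left mem_children.1

theorem maxChild_eq_self {C : PreConfig V} {u : V} (h : C.IsLeaf u) : C.maxChild u = u := by
  have h' : C.children u = ∅ := h
  rw [maxChild, dif_neg]
  simp [h']

theorem SwapEnabled.not_isLeaf {α : ℤ} {C : PreConfig V} {u : V} (h : SwapEnabled α C u) :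
    ¬ C.IsLeaf u := by
  intro hl
  have hl' : C.children u = ∅ := hl
  exact h.2.2 fun z hz => by simp [hl'] at hz

theorem SwapEnabled.parent_maxChild {α : ℤ} {C : PreConfig V} {u : V}
    (h : SwapEnabled α C u) : C.parent (C.maxChild u) = some u :=
  (maxChild_spec h.not_isLeaf).1

theorem SwapEnabled.parent_minChild {α : ℤ} {C : PreConfig V} {u : V}
    (h : SwapEnabled α C u) : C.parent (C.minChild u) = some u :=
  (minChild_spec h.not_isLeaf).1

theorem SwapEnabled.maxChild_ne_minChild {α : ℤ} (hα : 0 ≤ α) {C : PreConfig V} {u : V}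
    (h : SwapEnabled α C u) : C.maxChild u ≠ C.minChild u := by
  intro heq
  have hmax := (maxChild_spec h.not_isLeaf).2
  have hmin := (minChild_spec h.not_isLeaf).2
  rw [heq] at hmax
  refine h.2.2 fun z hz z' hz' => ?_
  have h₁ := height_le_maxH hz
  have h₂ := height_le_maxH hz'
  have h₃ := minH_le_height hz
  have h₄ := minH_le_height hz'
  rw [abs_le]
  constructor <;> linarith

/-- The node `max(max(u))` moved by a swap at `u` is either a grandchild of `u`, or, when
`max(u)` is a leaf, the child `max(u)` itself. -/
theorem SwapEnabled.parent_maxChild_maxChild {α : ℤ} {C : PreConfig V} {u : V}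
    (h : SwapEnabled α C u) :
    C.parent (C.maxChild (C.maxChild u)) = some u ∨
      C.parent (C.maxChild (C.maxChild u)) = some (C.maxChild u) := by
  by_cases hl : C.IsLeaf (C.maxChild u)
  · left
    rw [maxChild_eq_self hl]
    exact h.parent_maxChild
  · exact Or.inr (maxChild_spec hl).1

namespace Step

variable {α : ℤ} {C C' : PreConfig V} {A : Finset V}

theorem parent_eq_none_iff (hstep : Step α C C' A) (v : V) :
    C'.parent v = none ↔ C.parent v = none := by
  by_cases hk : ∀ u ∈ A, SwapEnabled α C u →
      v ≠ C.minChild u ∧ v ≠ C.maxChild (C.maxChild u)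
  · rw [hstep.parent_keep v hk]
  · push Not at hk
    obtain ⟨u, hu, hs, hv⟩ := hk
    by_cases hmin : v = C.minChild u
    · subst hmin
      simp [hstep.swap_out u hu hs, hs.parent_minChild]
    · obtain rfl := hv hmin
      rcases hs.parent_maxChild_maxChild with h | h <;> simp [hstep.swap_in u hu hs, h]

/-- A node that is not the minimum child of a swapping node has, after the step, a proper
ancestor of `C` as its parent. -/
theorem exists_ancestor_parent (hstep : Step α C C' A) {v y : V} (hvy : C.parent v = some y)
    (hmin : ∀ u ∈ A, SwapEnabled α C u → v ≠ C.minChild u) :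
    ∃ a, C.Reaches y a ∧ C'.parent v = some a := by
  by_cases hmax : ∃ u ∈ A, SwapEnabled α C u ∧ v = C.maxChild (C.maxChild u)
  · obtain ⟨u, hu, hs, rfl⟩ := hmax
    refine ⟨u, ?_, hstep.swap_in u hu hs⟩
    rcases hs.parent_maxChild_maxChild with h | h
    · obtain rfl : u = y := Option.some.inj (h.symm.trans hvy)
      exact Relation.ReflTransGen.refl
    · obtain rfl : C.maxChild u = y := Option.some.inj (h.symm.trans hvy)
      exact Relation.ReflTransGen.single hs.parent_maxChild
  · push Not at hmax
    refine ⟨y, Relation.ReflTransGen.refl, ?_⟩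
    rw [hstep.parent_keep v fun u hu hs => ⟨hmin u hu hs, hmax u hu hs⟩, hvy]

theorem reaches_of_ancestors_reach (hα : 0 ≤ α) (hstep : Step α C C' A) {v y r : V}
    (hvy : C.parent v = some y) (hy : ∀ a, C.Reaches y a → C'.Reaches a r) :
    C'.Reaches v r := by
  by_cases hmin : ∃ u ∈ A, SwapEnabled α C u ∧ v = C.minChild u
  · obtain ⟨u, hu, hs, rfl⟩ := hmin
    obtain rfl : u = y := Option.some.inj (hs.parent_minChild.symm.trans hvy)
    obtain ⟨a, ha, hpa⟩ := hstep.exists_ancestor_parent hs.parent_maxChild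
      (fun u' _ hs' heq => by
        have hp := hs'.parent_minChild
        rw [← heq, hs.parent_maxChild] at hp
        obtain rfl := Option.some.inj hp
        exact hs.maxChild_ne_minChild hα heq)
    exact Relation.ReflTransGen.head (hstep.swap_out u hu hs)
      (Relation.ReflTransGen.head hpa (hy a ha))
  · push Not at hmin
    obtain ⟨a, ha, hpa⟩ := hstep.exists_ancestor_parent hvy hmin
    exact Relation.ReflTransGen.head hpa (hy a ha)

theorem reaches_root (hα : 0 ≤ α) (hstep : Step α C C' A) {r : V}
    (hr : C.parent r = none) {v : V} (hv : C.Reaches v r) :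
    ∀ a, C.Reaches v a → C'.Reaches a r := by
  induction hv using Relation.ReflTransGen.head_induction_on with
  | refl =>
    intro a ha
    rcases Relation.ReflTransGen.cases_head ha with rfl | ⟨y, hy, _⟩
    · exact Relation.ReflTransGen.refl
    · simp [hr] at hy
  | head hvy _ ih =>
    intro a ha
    rcases Relation.ReflTransGen.cases_head ha with rfl | ⟨z, hz, hza⟩
    · exact hstep.reaches_of_ancestors_reach hα hvy ih
    · obtain rfl := Option.some.inj (hvy.symm.trans hz)
      exact ih a hza

end Step

end PreConfig

/-- If `C` is a configuration whose underlying graph is a rooted tree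
with root `r`, then after any execution step `C →_A C'`, the underlying graph of
`C'` is still a directed rooted tree with the same root `r`. -/
theorem stmt0 {V : Type*} [Fintype V] [LinearOrder V] (α : ℤ) (hα : 1 ≤ α)
    (C C' : PreConfig V) (A : Finset V) (r : V)
    (hT : C.IsTree r) (hstep : PreConfig.Step α C C' A) :
    C'.IsTree r := by
  obtain ⟨hr, huniq, hreach⟩ := hT
  exact ⟨(hstep.parent_eq_none_iff r).2 hr,
    fun v hv => huniq v ((hstep.parent_eq_none_iff v).1 hv),
    fun v => hstep.reaches_root (by lia) hr (hreach v) v Relation.ReflTransGen.refl⟩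
end

section
/- If C is a configuration in which no node is enabled (i.e., for every node u, stable(u) holds and the swap guard of u is false), then in C every node u is balanced and has correct height information, i.e., h(u) = h*(u) for all u. -/
open scoped Classical

namespace PreConfig

variable {V : Type*} [Fintype V] [LinearOrder V]

theorem exists_child_height_eq_maxH {C : PreConfig V} {u : V} (hu : ¬ C.IsLeaf u) :
    ∃ v, C.parent v = some u ∧ C.height v = C.maxH u := by
  have hne : (C.children u).Nonempty := Finset.nonempty_iff_ne_empty.2 hu
  obtain ⟨v, hv, h⟩ := Finset.exists_mem_eq_sup' hne C.height
  exact ⟨v, mem_children.1 hv, by rw [maxH, dif_pos hne, h]⟩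

/-- A stable node is strictly higher than its children. -/
theorem Stable.height_child_lt {C : PreConfig V} {u v : V} (hu : C.Stable u)
    (hv : C.parent v = some u) : C.height v + 1 ≤ C.height u := by
  have hmem : v ∈ C.children u := mem_children.2 hv
  have hne : (C.children u).Nonempty := ⟨v, hmem⟩
  have hle : C.height v ≤ C.maxH u := by
    rw [maxH, dif_pos hne]
    exact Finset.le_sup' C.height hmem
  rcases hu with ⟨hl, -⟩ | ⟨-, h⟩
  · exact absurd hl hne.ne_empty
  · omega

theorem height_nonneg_of_stable {C : PreConfig V} (hs : ∀ u, C.Stable u) (u : V) :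
    0 ≤ C.height u := by
  have : Nonempty V := ⟨u⟩
  obtain ⟨m, hm⟩ := Finite.exists_min C.height
  rcases hs m with ⟨-, h⟩ | ⟨hl, -⟩
  · exact h ▸ hm u
  · obtain ⟨v, hv, -⟩ := exists_child_height_eq_maxH hl
    have := (hs m).height_child_lt hv
    have := hm v
    omega

theorem exists_path_of_stable {C : PreConfig V} (hs : ∀ u, C.Stable u) (n : ℕ) :
    ∀ u, C.height u = n →
      ∃ f : ℕ → V, f 0 = u ∧ ∀ i < n, C.parent (f (i + 1)) = some (f i) := by
  induction n with
  | zero => exact fun u _ => ⟨fun _ => u, rfl, by simp⟩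
  | succ n ih =>
    intro u hu
    rcases hs u with ⟨-, h⟩ | ⟨hl, h⟩
    · omega
    · obtain ⟨v, hv, hmax⟩ := exists_child_height_eq_maxH hl
      obtain ⟨f, hf0, hf⟩ := ih v (by push_cast at hu; omega)
      refine ⟨fun i => Nat.casesOn i u f, rfl, fun i hi => ?_⟩
      cases i with
      | zero => simpa [hf0] using hv
      | succ i => exact hf i (by omega)

theorem path_length_le_height_of_stable {C : PreConfig V} (hs : ∀ u, C.Stable u) {n : ℕ}
    {f : ℕ → V} (hf : ∀ i < n, C.parent (f (i + 1)) = some (f i)) :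
    (n : ℤ) ≤ C.height (f 0) := by
  have key : ∀ i ≤ n, C.height (f i) + i ≤ C.height (f 0) := by
    intro i
    induction i with
    | zero => simp
    | succ i ih =>
      intro hi
      have := ih (by omega)
      have := (hs (f i)).height_child_lt (hf i (by omega))
      push_cast
      omega
  have := key n le_rfl
  have := height_nonneg_of_stable hs (f n)
  omega

/-- If every node is stable, every height value is correct. -/
theorem height_eq_hstar_of_stable {C : PreConfig V} (hs : ∀ u, C.Stable u) (u : V) :
    C.height u = (C.hstar u : ℤ) := by
  obtain ⟨n, hn⟩ := Int.eq_ofNat_of_zero_le (height_nonneg_of_stable hs u)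
  have hgreatest : IsGreatest
      {n : ℕ | ∃ f : ℕ → V, f 0 = u ∧ ∀ i < n, C.parent (f (i + 1)) = some (f i)} n := by
    refine ⟨exists_path_of_stable hs n u hn, ?_⟩
    rintro m ⟨f, rfl, hf⟩
    have := path_length_le_height_of_stable hs hf
    omega
  rw [hstar, hgreatest.csSup_eq, hn]

end PreConfig

/-- If no node is enabled in `C`, then every node of `C` is balanced
and has correct height information, i.e., `h(u) = h*(u)` for all `u`. -/
theorem stmt1 {V : Type*} [Fintype V] [LinearOrder V] (α : ℤ) (hα : 1 ≤ α)
    (C : PreConfig V) (r : V) (hT : C.IsTree r)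
    (hquiet : ∀ u, ¬ PreConfig.Enabled α C u) :
    ∀ u, PreConfig.Balanced α C u ∧ C.height u = (C.hstar u : ℤ) := by
  have hs : ∀ u, C.Stable u := fun u => not_not.1 fun h => hquiet u (Or.inl h)
  exact fun u => ⟨not_not.1 fun h => hquiet u (Or.inr ⟨hs u, hs _, h⟩),
    PreConfig.height_eq_hstar_of_stable hs u⟩
end

section
/- Let α ≥ 1 be an integer and let T be a finite rooted tree with n nodes and root r such that every internal node of T has at least two children and, for every node u and every pair of children z, z' of u, |h*(z) − h*(z')| ≤ α. Then n ≥ 2^{⌊h*(r)/(α+1)⌋}; in particular the height of T is at most (α+1)·(log₂ n + 1), i.e., O(log n). -/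
open scoped Classical

namespace PreConfig

variable {V : Type*}

theorem IsTree.exists_depth {C : PreConfig V} {r : V} (hT : C.IsTree r) :
    ∃ d : V → ℕ, ∀ v u, C.parent v = some u → d v = d u + 1 := by
  obtain ⟨hr, -, hreach⟩ := hT
  let g : Option V → Option V := fun o => o.bind C.parent
  have hg : ∀ k, g^[k] none = none := fun k => Function.iterate_fixed rfl k
  have hex : ∀ v, ∃ k, g^[k] (some v) = some r := by
    intro v
    have h : Relation.ReflTransGen (fun x y => C.parent x = some y) v r := hreach v
    induction h using Relation.ReflTransGen.head_induction_on with
    | refl => exact ⟨0, rfl⟩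
    | head hxy _ ih =>
      obtain ⟨k, hk⟩ := ih
      refine ⟨k + 1, ?_⟩
      rw [Function.iterate_succ_apply]
      simpa [g, hxy] using hk
  have hlt : ∀ v k l, g^[k] (some v) = some r → g^[l] (some v) = some r → l ≤ k := by
    intro v k l hk hl
    by_contra! hkl
    obtain ⟨m, rfl⟩ := Nat.exists_eq_add_of_lt hkl
    rw [show k + m + 1 = (m + 1) + k by omega, Function.iterate_add_apply, hk,
      Function.iterate_succ_apply] at hl
    simp [g, hr] at hl
    exact absurd (hl.symm.trans (hg m)) (by simp)
  choose d hd using hex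
  refine ⟨d, fun v u hvu => ?_⟩
  have h : g^[d u + 1] (some v) = some r := by
    rw [Function.iterate_succ_apply]
    simpa [g, hvu] using hd u
  exact le_antisymm (hlt v _ _ h (hd v)) (hlt v _ _ (hd v) h)

theorem bddAbove_pathLengths [Finite V] {C : PreConfig V} {d : V → ℕ}
    (hd : ∀ v u, C.parent v = some u → d v = d u + 1) (u : V) :
    BddAbove {n : ℕ | ∃ f : ℕ → V, f 0 = u ∧ ∀ i < n, C.parent (f (i + 1)) = some (f i)} := by
  obtain ⟨M, hM⟩ := (Set.finite_range d).bddAbove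
  refine ⟨M, ?_⟩
  rintro n ⟨f, -, hf⟩
  have h : ∀ i ≤ n, i ≤ d (f i) := by
    intro i
    induction i with
    | zero => simp
    | succ i ih =>
      intro hi
      have := hd _ _ (hf i hi)
      have := ih (by omega)
      omega
  exact (h n le_rfl).trans (hM ⟨_, rfl⟩)

theorem exists_child_le_hstar [Fintype V] [LinearOrder V] {C : PreConfig V} {d : V → ℕ}
    (hd : ∀ v u, C.parent v = some u → d v = d u + 1) {u : V} (hu : 0 < C.hstar u) :
    ∃ z ∈ C.children u, C.hstar u ≤ C.hstar z + 1 := by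
  have hmem : C.hstar u ∈
      {n : ℕ | ∃ f : ℕ → V, f 0 = u ∧ ∀ i < n, C.parent (f (i + 1)) = some (f i)} :=
    Nat.sSup_mem ⟨0, fun _ => u, rfl, by simp⟩ (bddAbove_pathLengths hd u)
  obtain ⟨f, hf0, hf⟩ := hmem
  refine ⟨f 1, ?_, ?_⟩
  · simpa [children, hf0] using hf 0 hu
  · have : C.hstar u - 1 ≤ C.hstar (f 1) :=
      le_csSup (bddAbove_pathLengths hd (f 1))
        ⟨fun i => f (i + 1), rfl, fun i hi => hf (i + 1) (by omega)⟩
    omega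

theorem Reaches.depth_lt_or_eq {C : PreConfig V} {d : V → ℕ}
    (hd : ∀ v u, C.parent v = some u → d v = d u + 1) {x y : V} (h : C.Reaches x y) :
    d y < d x ∨ x = y := by
  unfold Reaches at h
  induction h with
  | refl => exact Or.inr rfl
  | tail _ hbc ih =>
    have := hd _ _ hbc
    rcases ih with ih | rfl <;> left <;> omega

theorem disjoint_subtree_of_depth_eq {C : PreConfig V} {d : V → ℕ}
    (hd : ∀ v u, C.parent v = some u → d v = d u + 1) {z z' : V} (hzz' : z ≠ z')
    (hdz : d z = d z') : Disjoint (C.subtree z) (C.subtree z') := by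
  rw [Set.disjoint_left]
  intro x hx hx'
  have huniq : Relator.RightUnique (fun x y => C.parent x = some y) :=
    fun _ _ _ hb hc => Option.some.inj (hb.symm.trans hc)
  rcases Relation.ReflTransGen.total_of_right_unique huniq hx hx' with h | h
  · rcases Reaches.depth_lt_or_eq hd h with h | h
    · omega
    · exact hzz' h
  · rcases Reaches.depth_lt_or_eq hd h with h | h
    · omega
    · exact hzz' h.symm

theorem subtree_subset_of_parent {C : PreConfig V} {u z : V} (h : C.parent z = some u) :
    C.subtree z ⊆ C.subtree u :=
  fun _ hx => Relation.ReflTransGen.tail hx h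

theorem two_pow_le_ncard_subtree [Fintype V] [LinearOrder V] {C : PreConfig V} {d : V → ℕ}
    (hd : ∀ v u, C.parent v = some u → d v = d u + 1) {α : ℤ} (hα : 0 ≤ α)
    (hdeg : ∀ u, ¬ C.IsLeaf u → 2 ≤ (C.children u).card)
    (hbal : ∀ u, ∀ z ∈ C.children u, ∀ z' ∈ C.children u,
      |(C.hstar z : ℤ) - (C.hstar z' : ℤ)| ≤ α) (k : ℕ) (u : V)
    (hu : (k : ℤ) * (α + 1) ≤ C.hstar u) : 2 ^ k ≤ (C.subtree u).ncard := by
  induction k generalizing u with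
  | zero =>
    have : (C.subtree u).Nonempty := ⟨u, Relation.ReflTransGen.refl⟩
    exact this.ncard_pos
  | succ k ih =>
    push_cast at hu
    have hk : 0 ≤ (k : ℤ) * (α + 1) := by positivity
    have hpos : 0 < C.hstar u := by
      have : (0 : ℤ) < C.hstar u := by linarith
      exact_mod_cast this
    obtain ⟨z, hz, hzu⟩ := exists_child_le_hstar hd hpos
    have hleaf : ¬ C.IsLeaf u := Finset.ne_empty_of_mem hz
    obtain ⟨z', hz', hne⟩ := Finset.exists_mem_ne (hdeg u hleaf) z
    have hzu' : (C.hstar u : ℤ) ≤ C.hstar z + 1 := by exact_mod_cast hzu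
    have hab := (abs_le.mp (hbal u z hz z' hz')).2
    have h1 := ih z (by linarith)
    have h2 := ih z' (by linarith)
    have hp : C.parent z = some u := by simpa [children] using hz
    have hp' : C.parent z' = some u := by simpa [children] using hz'
    have hdisj := disjoint_subtree_of_depth_eq hd hne.symm
      ((hd _ _ hp).trans (hd _ _ hp').symm)
    calc 2 ^ (k + 1) = 2 ^ k + 2 ^ k := by ring
      _ ≤ (C.subtree z).ncard + (C.subtree z').ncard := add_le_add h1 h2
      _ = (C.subtree z ∪ C.subtree z').ncard := (Set.ncard_union_eq hdisj).symm
      _ ≤ (C.subtree u).ncard := Set.ncard_le_ncard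
          (Set.union_subset (subtree_subset_of_parent hp) (subtree_subset_of_parent hp'))

end PreConfig

/-- A finite rooted tree with `n` nodes in which every internal node
has at least two children and the actual heights of any two children of a node
differ by at most `α` satisfies `n ≥ 2 ^ ⌊h*(r) / (α+1)⌋`; in particular its height
is at most `(α+1) · (log₂ n + 1)`. -/
theorem stmt2 {V : Type*} [Fintype V] [LinearOrder V] (α : ℤ) (hα : 1 ≤ α)
    (C : PreConfig V) (r : V) (hT : C.IsTree r)
    (hdeg : ∀ u, ¬ C.IsLeaf u → 2 ≤ (C.children u).card)
    (hbal : ∀ u, ∀ z ∈ C.children u, ∀ z' ∈ C.children u,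
      |(C.hstar z : ℤ) - (C.hstar z' : ℤ)| ≤ α) :
    (2 : ℤ) ^ (((C.hstar r : ℤ) / (α + 1)).toNat) ≤ (Fintype.card V : ℤ) ∧
    (C.hstar r : ℤ) ≤ (α + 1) * ((Nat.log 2 (Fintype.card V) : ℤ) + 1) := by
  obtain ⟨d, hd⟩ := hT.exists_depth
  have hα1 : 0 < α + 1 := by omega
  set q : ℤ := (C.hstar r : ℤ) / (α + 1)
  have hq0 : 0 ≤ q := Int.ediv_nonneg (by positivity) hα1.le
  have hqn : (q.toNat : ℤ) = q := Int.toNat_of_nonneg hq0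
  have hcard : 2 ^ q.toNat ≤ Fintype.card V := by
    refine (PreConfig.two_pow_le_ncard_subtree hd (by omega) hdeg hbal q.toNat r ?_).trans ?_
    · rw [hqn]
      exact Int.ediv_mul_le _ hα1.ne'
    · exact (Set.ncard_le_card _).trans_eq Nat.card_eq_fintype_card
  refine ⟨by exact_mod_cast hcard, ?_⟩
  have hlog : q ≤ Nat.log 2 (Fintype.card V) := by
    rw [← hqn]
    exact_mod_cast Nat.le_log_of_pow_le (by norm_num) hcard
  have hlt : (C.hstar r : ℤ) < (q + 1) * (α + 1) := Int.lt_ediv_add_one_mul_self _ hα1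
  nlinarith
end

section
/- If a configuration C contains no bad nodes and C →_A C' is any execution step, then C' contains no bad nodes; consequently, in any execution starting from a configuration with no bad nodes, every configuration contains no bad nodes. -/
open scoped Classical

namespace PreConfig

variable {V : Type*} [Fintype V] [LinearOrder V]

/-- Heights are nonnegative and strictly decrease from parent to child. -/
def Decreasing (C : PreConfig V) : Prop :=
  (∀ u, 0 ≤ C.height u) ∧ ∀ v u, C.parent v = some u → C.height v < C.height u

theorem not_isLeaf_of_parent {C : PreConfig V} {u v : V} (h : C.parent v = some u) :
    ¬ C.IsLeaf u :=
  Finset.ne_empty_of_mem (mem_children.2 h)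

theorem le_maxH {C : PreConfig V} {u v : V} (h : C.parent v = some u) :
    C.height v ≤ C.maxH u := by
  have hv := mem_children.2 h
  rw [maxH, dif_pos ⟨v, hv⟩]
  exact Finset.le_sup' C.height hv

theorem minH_le {C : PreConfig V} {u v : V} (h : C.parent v = some u) :
    C.minH u ≤ C.height v := by
  have hv := mem_children.2 h
  rw [minH, dif_pos ⟨v, hv⟩]
  exact Finset.inf'_le C.height hv

theorem height_minChild {C : PreConfig V} {u : V} (h : ¬ C.IsLeaf u) :
    C.height (C.minChild u) = C.minH u := by
  have hne : (C.children u).Nonempty := Finset.nonempty_iff_ne_empty.2 h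
  have hf : ((C.children u).filter fun v => C.height v = C.minH u).Nonempty := by
    obtain ⟨v, hv, he⟩ := Finset.exists_mem_eq_inf' hne C.height
    exact ⟨v, Finset.mem_filter.2 ⟨hv, by rw [minH, dif_pos hne, he]⟩⟩
  have hm := Finset.min'_mem _ hf
  rw [minChild, dif_pos hf]
  exact (Finset.mem_filter.1 hm).2

theorem forall_not_bad_iff_decreasing {C : PreConfig V} :
    (∀ u, ¬ C.Bad u) ↔ C.Decreasing := by
  constructor
  · intro h
    have hlt : ∀ v u, C.parent v = some u → C.height v < C.height u := fun v u hp =>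
      (le_maxH hp).trans_lt
        (not_le.1 fun hle => h u (Or.inl ⟨not_isLeaf_of_parent hp, hle⟩))
    refine ⟨fun u => ?_, hlt⟩
    obtain ⟨w, -, hw⟩ := Finset.exists_min_image Finset.univ C.height ⟨u, Finset.mem_univ u⟩
    have hleaf : C.IsLeaf w := by
      by_contra hl
      exact (hlt _ _ (maxChild_spec hl).1).not_ge (hw _ (Finset.mem_univ _))
    have h0 : 0 ≤ C.height w := not_lt.1 fun hneg => h w (Or.inr ⟨hleaf, hneg⟩)
    exact h0.trans (hw u (Finset.mem_univ u))
  · rintro ⟨h0, hlt⟩ u (⟨hl, hle⟩ | ⟨-, hneg⟩)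
    · obtain ⟨hp, he⟩ := maxChild_spec hl
      exact (hlt _ _ hp).not_ge (he ▸ hle)
    · exact hneg.not_ge (h0 u)

theorem Decreasing.newHeight_le {C : PreConfig V} (h : C.Decreasing) (u : V) :
    C.newHeight u ≤ C.height u := by
  unfold newHeight
  split_ifs with hl
  · exact h.1 u
  · obtain ⟨hp, he⟩ := maxChild_spec hl
    have := h.2 _ _ hp
    omega

theorem Decreasing.newHeight_nonneg {C : PreConfig V} (h : C.Decreasing) (u : V) :
    0 ≤ C.newHeight u := by
  unfold newHeight
  split_ifs with hl
  · exact le_rfl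
  · have := h.1 (C.maxChild u)
    rw [(maxChild_spec hl).2] at this
    omega

theorem lt_newHeight {C : PreConfig V} {u v : V} (hp : C.parent v = some u) :
    C.height v < C.newHeight u := by
  have := le_maxH hp
  rw [newHeight, if_neg (not_isLeaf_of_parent hp)]
  omega

theorem Step.height_eq_of_stable {α : ℤ} {C C' : PreConfig V} {A : Finset V}
    (hs : Step α C C' A) {u : V} (hu : C.Stable u) : C'.height u = C.height u :=
  hs.height_keep u fun h => h.2 hu

theorem Step.height_eq {α : ℤ} {C C' : PreConfig V} {A : Finset V}
    (hs : Step α C C' A) (u : V) :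
    C'.height u = C.newHeight u ∨ C'.height u = C.height u := by
  by_cases hu : u ∈ A ∧ C.UpdateEnabled u
  · exact Or.inl (hs.height_update u hu.1 hu.2)
  · exact Or.inr (hs.height_keep u hu)

theorem Step.height_le {α : ℤ} {C C' : PreConfig V} {A : Finset V}
    (hs : Step α C C' A) (h : C.Decreasing) (u : V) : C'.height u ≤ C.height u := by
  rcases hs.height_eq u with he | he
  · exact he ▸ h.newHeight_le u
  · exact he.le

/-- The two edges created by a swap go down in height. -/
theorem SwapEnabled.height_lt {α : ℤ} (hα : 1 ≤ α) {C : PreConfig V} (h : C.Decreasing) {u : V}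
    (hu : SwapEnabled α C u) :
    C.height (C.minChild u) < C.height (C.maxChild u) ∧
      C.height (C.maxChild (C.maxChild u)) < C.height u := by
  obtain ⟨-, hm, hb⟩ := hu
  simp only [Balanced, not_forall, not_le, mem_children] at hb
  obtain ⟨z, hz, z', hz', hzz⟩ := hb
  have hl := not_isLeaf_of_parent hz
  obtain ⟨hp, he⟩ := maxChild_spec hl
  have hmin : C.height (C.minChild u) < C.height (C.maxChild u) := by
    rw [height_minChild hl, he]
    have h1 := le_maxH hz
    have h2 := le_maxH hz'
    have h3 := minH_le hz
    have h4 := minH_le hz'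
    rcases lt_abs.1 hzz with h5 | h5 <;> omega
  have hml : ¬ C.IsLeaf (C.maxChild u) := by
    have := h.1 (C.minChild u)
    rcases hm with ⟨-, h0⟩ | ⟨hn, -⟩
    · omega
    · exact hn
  exact ⟨hmin, (h.2 _ _ (maxChild_spec hml).1).trans (h.2 _ _ hp)⟩

theorem Step.decreasing {α : ℤ} (hα : 1 ≤ α) {C C' : PreConfig V} {A : Finset V}
    (hs : Step α C C' A) (h : C.Decreasing) : C'.Decreasing := by
  refine ⟨fun u => ?_, fun v u hp => (hs.height_le h v).trans_lt ?_⟩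
  · rcases hs.height_eq u with he | he
    · exact he ▸ h.newHeight_nonneg u
    · exact he ▸ h.1 u
  by_cases hk : ∀ w ∈ A, SwapEnabled α C w →
      v ≠ C.minChild w ∧ v ≠ C.maxChild (C.maxChild w)
  · rw [hs.parent_keep v hk] at hp
    rcases hs.height_eq u with he | he
    · exact he ▸ lt_newHeight hp
    · exact he ▸ h.2 v u hp
  · push Not at hk
    obtain ⟨w, hwA, hw, hv⟩ := hk
    obtain ⟨hmin, hmax⟩ := hw.height_lt hα h
    by_cases hvm : v = C.minChild w
    · subst hvm
      obtain rfl : C.maxChild w = u :=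
        Option.some_injective _ ((hs.swap_out w hwA hw).symm.trans hp)
      rwa [hs.height_eq_of_stable hw.2.1]
    · obtain rfl := hv hvm
      obtain rfl : w = u := Option.some_injective _ ((hs.swap_in w hwA hw).symm.trans hp)
      rwa [hs.height_eq_of_stable hw.1]

end PreConfig

/-- If a configuration `C` contains no bad nodes and `C →_A C'` is any
execution step, then `C'` contains no bad nodes; consequently, in any execution
starting from a configuration with no bad nodes, every configuration contains no
bad nodes. -/
theorem stmt3 {V : Type*} [Fintype V] [LinearOrder V] (α : ℤ) (hα : 1 ≤ α) :
    (∀ (C C' : PreConfig V) (A : Finset V) (r : V), C.IsTree r →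
      PreConfig.Step α C C' A → (∀ u, ¬ C.Bad u) → ∀ u, ¬ C'.Bad u) ∧
    (∀ (Cs : ℕ → PreConfig V) (As : ℕ → Finset V) (r : V), (Cs 0).IsTree r →
      (∀ n, PreConfig.Step α (Cs n) (Cs (n + 1)) (As n)) →
      (∀ u, ¬ (Cs 0).Bad u) → ∀ n u, ¬ (Cs n).Bad u) := by
  have step : ∀ (C C' : PreConfig V) (A : Finset V), PreConfig.Step α C C' A →
      (∀ u, ¬ C.Bad u) → ∀ u, ¬ C'.Bad u := fun C C' A hs h =>
    PreConfig.forall_not_bad_iff_decreasing.2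
      (hs.decreasing hα (PreConfig.forall_not_bad_iff_decreasing.1 h))
  refine ⟨fun C C' A _ _ => step C C' A, fun Cs As _ _ hs h0 n => ?_⟩
  induction n with
  | zero => exact h0
  | succ n ih => exact step _ _ _ (hs n) ih
end
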